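/- arXiv:2503.23320 — 3 statements merged into one kernel-verified Lean document; each statement's English description precedes it below -/
import Mathlib

section
/- With notation as in the context, the ideal $\mathcal{J}(I) = \sum_{i=1}^{s} Z_i \, (\Delta D)^{i-1}$ of $\mathbb{Z}[G]$ equals the ideal generated by the elements $e(\lambda,\mu)\,(\sigma - 1)^{\,i-1-j}$, where $i$ and $j$ range over all integers with $0 \le j \le i-1$ and $1 \le i \le s$, $\lambda = (l_1, \dots, l_{s-i})$ ranges over all tuples with $1 \le l_1 < l_2 < \dots < l_{s-i} \le s$, $\mu = (m_1, \dots, m_j)$ ranges over all tuples with $1 \le m_1 \le m_2 \le \dots \le m_j \le s$, and $e(\lambda,\mu) := \prod_{r=1}^{s-i} N(I_{l_r}) \cdot \prod_{r=1}^{j} (i_{m_r} - 1)$. -/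
open scoped Classical BigOperators

/-- `N(H) = ∑_{h ∈ H} h`, the norm element of a subgroup `H` in the group ring `ℤ[G]`. -/
noncomputable def normElt (G : Type) [CommGroup G] [Fintype G] (H : Subgroup G) :
    MonoidAlgebra ℤ G :=
  ∑ h : H, MonoidAlgebra.of ℤ G (h : G)

/-- The relative augmentation ideal `ΔD = ker(ℤ[G] → ℤ[G/D])`. -/
noncomputable def relAugIdeal (G : Type) [CommGroup G] [Fintype G] (D : Subgroup G) :
    Ideal (MonoidAlgebra ℤ G) :=
  RingHom.ker (MonoidAlgebra.mapDomainRingHom ℤ (QuotientGroup.mk' D))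

/-- Powers of the ideal generated by a finite family `a` and one more element `b`, in terms of
the ordered monomials in these generators. -/
theorem span_range_insert_pow {R : Type*} [CommRing R] {s : ℕ} (a : Fin s → R) (b : R) (n : ℕ) :
    Ideal.span (insert b (Set.range a)) ^ n =
      Ideal.span {x | ∃ j ≤ n, ∃ m : Fin j → Fin s, Monotone m ∧
        x = (∏ r, a (m r)) * b ^ (n - j)} := by
  have monomial_mem (n j : ℕ) (hj : j ≤ n) (m : Fin j → Fin s) :
      (∏ r, a (m r)) * b ^ (n - j) ∈ Ideal.span {x | ∃ j ≤ n, ∃ m : Fin j → Fin s, Monotone m ∧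
        x = (∏ r, a (m r)) * b ^ (n - j)} :=
    Ideal.subset_span ⟨j, hj, m ∘ Tuple.sort m, Tuple.monotone_sort m, by
      simp only [Function.comp_apply]
      rw [Equiv.prod_comp (Tuple.sort m) fun r => a (m r)]⟩
  apply le_antisymm
  · induction n with
    | zero => simpa [Ideal.eq_top_iff_one] using monomial_mem 0 0 le_rfl Fin.elim0
    | succ n ih =>
      rw [pow_succ]
      refine (Ideal.mul_mono_left ih).trans ?_
      rw [Ideal.span_mul_span', Ideal.span_le]
      rintro _ ⟨_, ⟨j, hj, m, -, rfl⟩, y, rfl | ⟨k, rfl⟩, rfl⟩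
      · have h := monomial_mem (n + 1) j (by omega) m
        rwa [Nat.succ_sub hj, pow_succ, ← mul_assoc] at h
      · have h := monomial_mem (n + 1) (j + 1) (by omega) (Fin.cons k m)
        rw [Fin.prod_univ_succ, Nat.add_sub_add_right] at h
        simp only [Fin.cons_zero, Fin.cons_succ] at h
        simp only [SetLike.mem_coe]
        convert h using 1
        ring
  · rw [Ideal.span_le]
    rintro _ ⟨j, hj, m, -, rfl⟩
    have hprod : ∏ r, a (m r) ∈ Ideal.span (insert b (Set.range a)) ^ j := by
      simpa using Ideal.prod_mem_prod (s := Finset.univ) (x := fun r => a (m r))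
        (I := fun _ => Ideal.span (insert b (Set.range a)))
        fun r _ => Ideal.subset_span (Or.inr ⟨m r, rfl⟩)
    rw [SetLike.mem_coe, ← Nat.add_sub_cancel' hj, pow_add, Nat.add_sub_cancel_left]
    exact Ideal.mul_mem_mul hprod
      (Ideal.pow_mem_pow (Ideal.subset_span (Set.mem_insert b _)) _)

/-- The subgroup of those `g` with `g - 1` in a given ideal of the group ring. -/
def subgroupOfIdeal {G : Type} [CommGroup G] (J : Ideal (MonoidAlgebra ℤ G)) : Subgroup G where
  carrier := {g | MonoidAlgebra.of ℤ G g - 1 ∈ J}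
  one_mem' := by simp [MonoidAlgebra.one_def]
  mul_mem' {g h} hg hh := by
    have key : MonoidAlgebra.of ℤ G (g * h) - 1 =
        MonoidAlgebra.of ℤ G g * (MonoidAlgebra.of ℤ G h - 1) +
          (MonoidAlgebra.of ℤ G g - 1) := by
      rw [map_mul]; ring
    rw [Set.mem_ofPred_eq, key]
    exact J.add_mem (J.mul_mem_left _ hh) hg
  inv_mem' {g} hg := by
    have key : MonoidAlgebra.of ℤ G g⁻¹ - 1 =
        -MonoidAlgebra.of ℤ G g⁻¹ * (MonoidAlgebra.of ℤ G g - 1) := by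
      rw [neg_mul, mul_sub, ← map_mul, inv_mul_cancel, map_one]; ring
    rw [Set.mem_ofPred_eq, key]
    exact J.mul_mem_left _ hg

theorem mem_subgroupOfIdeal {G : Type} [CommGroup G] {J : Ideal (MonoidAlgebra ℤ G)} {g : G} :
    g ∈ subgroupOfIdeal J ↔ MonoidAlgebra.of ℤ G g - 1 ∈ J := Iff.rfl

theorem relAugIdeal_le {G : Type} [CommGroup G] [Fintype G] {D : Subgroup G}
    {J : Ideal (MonoidAlgebra ℤ G)} (hD : D ≤ subgroupOfIdeal J) : relAugIdeal G D ≤ J := by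
  intro x hx
  have hx' : MonoidAlgebra.mapDomain (QuotientGroup.mk' D) x = 0 := hx
  have sub_mem (y : MonoidAlgebra ℤ G) :
      y - MonoidAlgebra.mapDomain Quotient.out
        (MonoidAlgebra.mapDomain (QuotientGroup.mk' D) y) ∈ J := by
    induction y using MonoidAlgebra.induction_linear with
    | zero => simp
    | add y z hy hz =>
      rw [MonoidAlgebra.mapDomain_add, MonoidAlgebra.mapDomain_add, add_sub_add_comm]
      exact J.add_mem hy hz
    | single g n =>
      set k : G := Quotient.out (QuotientGroup.mk' D g) with hk
      have hmem : k⁻¹ * g ∈ D :=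
        QuotientGroup.eq.1 (QuotientGroup.out_eq' (QuotientGroup.mk' D g))
      have h := J.mul_mem_left (MonoidAlgebra.single k n) (mem_subgroupOfIdeal.1 (hD hmem))
      rw [mul_sub, mul_one, MonoidAlgebra.of_apply, MonoidAlgebra.single_mul_single,
        mul_inv_cancel_left, mul_one] at h
      rwa [MonoidAlgebra.mapDomain_single, MonoidAlgebra.mapDomain_single]
  have h := sub_mem x
  rwa [hx', MonoidAlgebra.mapDomain_zero, sub_zero] at h

theorem of_sub_one_mem_relAugIdeal {G : Type} [CommGroup G] [Fintype G] {D : Subgroup G} {d : G}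
    (hd : d ∈ D) : MonoidAlgebra.of ℤ G d - 1 ∈ relAugIdeal G D := by
  rw [relAugIdeal, RingHom.mem_ker, map_sub, map_one, sub_eq_zero,
    MonoidAlgebra.mapDomainRingHom_apply, MonoidAlgebra.of_apply, MonoidAlgebra.mapDomain_single,
    QuotientGroup.mk'_apply, (QuotientGroup.eq_one_iff d).2 hd, MonoidAlgebra.one_def]

/-- If `D` is generated by `σ` and the `gen j`, then `ΔD` is generated by `σ - 1` and the
`gen j - 1`. -/
theorem relAugIdeal_eq_span {G : Type} [CommGroup G] [Fintype G] {D : Subgroup G} {σ : G}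
    {s : ℕ} {gen : Fin s → G} (hD : D = Subgroup.closure (insert σ (Set.range gen))) :
    relAugIdeal G D = Ideal.span (insert (MonoidAlgebra.of ℤ G σ - 1)
      (Set.range fun j => MonoidAlgebra.of ℤ G (gen j) - 1)) := by
  apply le_antisymm
  · apply relAugIdeal_le
    rw [hD, Subgroup.closure_le]
    rintro _ (rfl | ⟨j, rfl⟩)
    · exact Ideal.subset_span (Set.mem_insert _ _)
    · exact Ideal.subset_span (Or.inr ⟨j, rfl⟩)
  · rw [Ideal.span_le]
    rintro _ (rfl | ⟨j, rfl⟩)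
    · exact of_sub_one_mem_relAugIdeal (hD ▸ Subgroup.subset_closure (Set.mem_insert _ _))
    · exact of_sub_one_mem_relAugIdeal (hD ▸ Subgroup.subset_closure (Or.inr ⟨j, rfl⟩))

/-- **Lemma on the generators of the Atsuta–Kataoka ideal `𝒥(I)`**
(`Shifted-Fitt-generators` in the paper).  Let `G` be a finite abelian group,
`I ⊆ D ⊆ G` subgroups with `D/I` cyclic generated by the image of `σ ∈ D`, and fix a
decomposition `I = I₁ × ⋯ × I_s` into cyclic subgroups `I_j = ⟨gen j⟩` (encoded by
injectivity of the multiplication map and the description of membership in `I`).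
Then `𝒥(I) = ∑_{i=1}^s Z_i (ΔD)^{i-1}` equals the ideal generated by the elements
`e(λ,μ)(σ-1)^{i-1-j}` with `1 ≤ i ≤ s`, `0 ≤ j ≤ i-1`, `λ` a strictly increasing
`(s-i)`-tuple in `{1,…,s}` and `μ` a non-decreasing `j`-tuple in `{1,…,s}`, where
`e(λ,μ) = ∏_r N(I_{λ r}) · ∏_r (gen (μ r) - 1)`. -/
theorem shifted_fitt_generators
    (G : Type) [CommGroup G] [Fintype G]
    (I D : Subgroup G) (hID : I ≤ D)
    (σ : G) (hσD : σ ∈ D)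
    (hσgen : ∀ d ∈ D, ∃ n : ℤ, d / σ ^ n ∈ I)
    (s : ℕ) (gen : Fin s → G)
    (hinj : Function.Injective
      (fun f : (j : Fin s) → Subgroup.zpowers (gen j) => ∏ j, (f j : G)))
    (hmem : ∀ g : G, g ∈ I ↔
      ∃ f : (j : Fin s) → Subgroup.zpowers (gen j), g = ∏ j, (f j : G)) :
    (∑ t ∈ Finset.Icc 1 s,
        Ideal.span {z : MonoidAlgebra ℤ G | ∃ l : Fin (s - t) → Fin s, StrictMono l ∧
            z = ∏ r, normElt G (Subgroup.zpowers (gen (l r)))} *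
          (relAugIdeal G D) ^ (t - 1))
      = Ideal.span {x : MonoidAlgebra ℤ G |
          ∃ t ∈ Finset.Icc 1 s, ∃ j < t, ∃ l : Fin (s - t) → Fin s, StrictMono l ∧
            ∃ m : Fin j → Fin s, Monotone m ∧
              x = (∏ r, normElt G (Subgroup.zpowers (gen (l r)))) *
                  (∏ r, (MonoidAlgebra.of ℤ G (gen (m r)) - 1)) *
                  (MonoidAlgebra.of ℤ G σ - 1) ^ (t - 1 - j)} := by
  have hgen (j : Fin s) : gen j ∈ I :=
    (hmem _).2 ⟨Pi.mulSingle j ⟨gen j, Subgroup.mem_zpowers _⟩, by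
      rw [Finset.prod_eq_single j (fun k _ hk => by simp [Pi.mulSingle_eq_of_ne hk]) (by simp)]
      simp⟩
  have hD : D = Subgroup.closure (insert σ (Set.range gen)) := by
    apply le_antisymm
    · intro d hd
      obtain ⟨n, hn⟩ := hσgen d hd
      obtain ⟨f, hf⟩ := (hmem _).1 hn
      rw [div_eq_iff_eq_mul] at hf
      rw [hf]
      refine mul_mem (prod_mem fun j _ => ?_)
        (zpow_mem (Subgroup.subset_closure (Set.mem_insert _ _)) n)
      have hle : Subgroup.zpowers (gen j) ≤ Subgroup.closure (insert σ (Set.range gen)) :=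
        Subgroup.zpowers_le.2 (Subgroup.subset_closure (Or.inr ⟨j, rfl⟩))
      exact hle (f j).2
    · rw [Subgroup.closure_le]
      rintro _ (rfl | ⟨j, rfl⟩)
      exacts [hσD, hID (hgen j)]
  rw [Ideal.sum_eq_sup, relAugIdeal_eq_span hD]
  simp only [span_range_insert_pow, Ideal.span_mul_span']
  apply le_antisymm
  · refine Finset.sup_le fun t ht => Ideal.span_mono ?_
    rintro _ ⟨_, ⟨l, hl, rfl⟩, _, ⟨j, hj, m, hm, rfl⟩, rfl⟩
    have ht1 := (Finset.mem_Icc.1 ht).1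
    exact ⟨t, ht, j, by omega, l, hl, m, hm, (mul_assoc _ _ _).symm⟩
  · rw [Ideal.span_le]
    rintro _ ⟨t, ht, j, hj, l, hl, m, hm, rfl⟩
    apply SetLike.le_def.1 (Finset.le_sup ht)
    exact Ideal.subset_span
      ⟨_, ⟨l, hl, rfl⟩, _, ⟨j, by omega, m, hm, rfl⟩, (mul_assoc _ _ _).symm⟩
end

section
/- Let $G$ be a finite abelian group, $I \leq G$ a subgroup, $\phi \in G$, and set $N(I) = \sum_{i \in I} i$ and $e_I = \frac{1}{|I|} N(I)$ in $\mathbb{Q}[G]$. Then the element $h = 1 - e_I \phi^{-1} + N(I) \;(= 1 - e_I(\phi^{-1} - |I|))$ is a unit of the group algebra $\mathbb{Q}[G]$. -/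
open scoped Classical BigOperators

/-- The norm element `N(I) = ∑_{i ∈ I} i` in `ℚ[G]`. -/
noncomputable def normQ (G : Type) [CommGroup G] [Fintype G] (I : Subgroup G) :
    MonoidAlgebra ℚ G :=
  ∑ h : I, MonoidAlgebra.of ℚ G (h : G)

/-- The idempotent `e_I = N(I)/|I|` in `ℚ[G]`. -/
noncomputable def idemQ (G : Type) [CommGroup G] [Fintype G] (I : Subgroup G) :
    MonoidAlgebra ℚ G :=
  (Nat.card I : ℚ)⁻¹ • normQ G I

theorem IsIdempotentElem.isUnit_one_sub_add_mul {R : Type*} [CommRing R] {e a : R}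
    (he : IsIdempotentElem e) (ha : IsUnit a) : IsUnit (1 - e + e * a) := by
  obtain ⟨b, hb⟩ := ha.exists_right_inv
  refine IsUnit.of_mul_eq_one (1 - e + e * b) ?_
  linear_combination (1 - a - b + a * b) * he.eq + e * hb

theorem isUnit_algebraMap_sub_of_pow_eq_one {K A : Type*} [Field K] [CommRing A] [Algebra K A]
    {c : K} {x : A} {m : ℕ} (hx : x ^ m = 1) (hc : c ^ m ≠ 1) :
    IsUnit (algebraMap K A c - x) := by
  refine isUnit_of_dvd_unit (sub_dvd_pow_sub_pow _ x m) ?_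
  rw [hx, ← map_pow, ← map_one (algebraMap K A), ← map_sub]
  exact (IsUnit.mk0 _ (sub_ne_zero.2 hc)).map _

theorem of_mul_normQ (G : Type) [CommGroup G] [Fintype G] (I : Subgroup G) (g : I) :
    MonoidAlgebra.of ℚ G (g : G) * normQ G I = normQ G I := by
  simp only [normQ, Finset.mul_sum, ← map_mul, ← Subgroup.coe_mul]
  exact Equiv.sum_comp (Equiv.mulLeft g) fun h : I => MonoidAlgebra.of ℚ G (h : G)

theorem normQ_mul_normQ (G : Type) [CommGroup G] [Fintype G] (I : Subgroup G) :
    normQ G I * normQ G I = (Nat.card I : ℚ) • normQ G I := by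
  conv_lhs => enter [1]; rw [normQ]
  simp [Finset.sum_mul, of_mul_normQ, -MonoidAlgebra.of_apply, Nat.cast_smul_eq_nsmul]

theorem card_smul_idemQ (G : Type) [CommGroup G] [Fintype G] (I : Subgroup G) :
    (Nat.card I : ℚ) • idemQ G I = normQ G I :=
  smul_inv_smul₀ (Nat.cast_ne_zero.2 Nat.card_pos.ne') _

theorem isIdempotentElem_idemQ (G : Type) [CommGroup G] [Fintype G] (I : Subgroup G) :
    IsIdempotentElem (idemQ G I) := by
  rw [IsIdempotentElem, idemQ, smul_mul_smul_comm, normQ_mul_normQ, mul_smul,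
    inv_smul_smul₀ (Nat.cast_ne_zero.2 Nat.card_pos.ne')]

/-- **The element `h = 1 - e_I φ⁻¹ + N(I)` is a unit of `ℚ[G]`** for any finite abelian
group `G`, subgroup `I ≤ G` and element `φ ∈ G`. -/
theorem h_is_unit
    (G : Type) [CommGroup G] [Fintype G] (I : Subgroup G) (φ : G) :
    IsUnit (1 - idemQ G I * MonoidAlgebra.of ℚ G φ⁻¹ + normQ G I) := by
  have hx : MonoidAlgebra.of ℚ G φ⁻¹ ^ Fintype.card G = 1 := by
    rw [← map_pow, pow_card_eq_one, map_one]
  have hc : (1 + Nat.card I : ℚ) ^ Fintype.card G ≠ 1 :=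
    (one_lt_pow₀ (lt_add_of_pos_right _ (Nat.cast_pos.2 Nat.card_pos)) Fintype.card_ne_zero).ne'
  convert (isIdempotentElem_idemQ G I).isUnit_one_sub_add_mul
    (isUnit_algebraMap_sub_of_pow_eq_one hx hc) using 1
  rw [← card_smul_idemQ, Algebra.smul_def, map_add, map_one]
  ring
end

section
/- Let $k \subseteq K$ be an extension of finite fields with $|k| = q$ and $[K : k] = f$, and let $G = \mathrm{Gal}(K/k)$, a cyclic group of order $f$ generated by the Frobenius automorphism $\sigma : x \mapsto x^q$. Then the multiplicative group $K^{\times}$, regarded as a module over the group ring $\mathbb{Z}[G]$, is isomorphic to $\mathbb{Z}[G]/(1 - q\,\sigma^{-1})$. -/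
open scoped Classical BigOperators

/-- The ideal `(1 - q σ⁻¹)` of `ℤ[G]`, where `G = Gal(K/k)`, `q = |k|` and `σ` is the
Frobenius automorphism. -/
noncomputable def frobIdeal (k K : Type) [Field k] [Field K] [Fintype k] [Algebra k K]
    (σ : K ≃ₐ[k] K) : Ideal (MonoidAlgebra ℤ (K ≃ₐ[k] K)) :=
  Ideal.span {1 - (Fintype.card k : MonoidAlgebra ℤ (K ≃ₐ[k] K)) *
      MonoidAlgebra.of ℤ (K ≃ₐ[k] K) σ⁻¹}

/-- The action of `ℤ[G]` on the units, written additively. -/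
noncomputable def groupRingUnitsAction (k K : Type) [Field k] [Field K] [Algebra k K] :
    MonoidAlgebra ℤ (K ≃ₐ[k] K) →ₐ[ℤ] Module.End ℤ (Additive Kˣ) :=
  (Representation.ofMulDistribMulAction (K ≃ₐ[k] K) Kˣ).asAlgebraHom

theorem groupRingUnitsAction_of_mul {k K : Type} [Field k] [Field K] [Algebra k K]
    (g : K ≃ₐ[k] K) (a : MonoidAlgebra ℤ (K ≃ₐ[k] K)) (x : Additive Kˣ) :
    ((groupRingUnitsAction k K (MonoidAlgebra.of ℤ _ g * a) x).toMul : K) =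
      g ((groupRingUnitsAction k K a x).toMul : K) := by
  rw [map_mul, groupRingUnitsAction, Representation.asAlgebraHom_of]
  rfl

theorem groupRingUnitsAction_intCast {k K : Type} [Field k] [Field K] [Algebra k K]
    (m : ℤ) (x : Additive Kˣ) :
    groupRingUnitsAction k K (m : MonoidAlgebra ℤ (K ≃ₐ[k] K)) x = m • x := by
  rw [map_intCast, Module.End.intCast_apply]

theorem of_pow_sub_card_pow_mem_frobIdeal {k K : Type} [Field k] [Field K] [Fintype k]
    [Algebra k K] (σ : K ≃ₐ[k] K) (n : ℕ) :
    MonoidAlgebra.of ℤ (K ≃ₐ[k] K) (σ ^ n) - (Fintype.card k : MonoidAlgebra ℤ _) ^ n ∈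
      frobIdeal k K σ := by
  have hbase : MonoidAlgebra.of ℤ (K ≃ₐ[k] K) σ - (Fintype.card k : MonoidAlgebra ℤ _) ∈
      frobIdeal k K σ := by
    refine Ideal.mem_span_singleton'.2 ⟨MonoidAlgebra.of ℤ (K ≃ₐ[k] K) σ, ?_⟩
    rw [mul_sub, mul_one, ← mul_assoc, ← (Nat.cast_commute _ _).eq, mul_assoc, ← map_mul,
      mul_inv_cancel, map_one, mul_one]
  induction n with
  | zero => simp [MonoidAlgebra.one_def]
  | succ n ih =>
    have h := add_mem (Ideal.mul_mem_left _ (MonoidAlgebra.of ℤ (K ≃ₐ[k] K) (σ ^ n)) hbase)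
      (Ideal.mul_mem_left _ (Fintype.card k : MonoidAlgebra ℤ (K ≃ₐ[k] K)) ih)
    convert h using 1
    rw [mul_sub, mul_sub, ← map_mul, ← pow_succ, ← pow_succ', (Nat.cast_commute _ _).eq]
    abel

theorem exists_intCast_sub_mem_frobIdeal {k K : Type} [Field k] [Field K] [Fintype k]
    [Algebra k K] (σ : K ≃ₐ[k] K) (hgen : ∀ g : K ≃ₐ[k] K, ∃ n : ℕ, σ ^ n = g)
    (a : MonoidAlgebra ℤ (K ≃ₐ[k] K)) :
    ∃ m : ℤ, a - (m : MonoidAlgebra ℤ (K ≃ₐ[k] K)) ∈ frobIdeal k K σ := by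
  induction a using MonoidAlgebra.induction_on with
  | of g =>
    obtain ⟨n, rfl⟩ := hgen g
    exact ⟨(Fintype.card k : ℤ) ^ n, by
      simpa using of_pow_sub_card_pow_mem_frobIdeal σ n⟩
  | add a b ha hb =>
    obtain ⟨m, hm⟩ := ha
    obtain ⟨n, hn⟩ := hb
    refine ⟨m + n, ?_⟩
    rw [Int.cast_add, add_sub_add_comm]
    exact add_mem hm hn
  | smul r a ha =>
    obtain ⟨m, hm⟩ := ha
    refine ⟨r * m, ?_⟩
    rw [Int.cast_mul, ← zsmul_eq_mul, ← smul_sub]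
    exact zsmul_mem hm r

theorem exists_pow_eq_of_forall_eq_pow_card {k K : Type} [Field k] [Field K] [Fintype k]
    [Fintype K] [Algebra k K] (σ : K ≃ₐ[k] K) (hσ : ∀ x, σ x = x ^ Fintype.card k)
    (g : K ≃ₐ[k] K) : ∃ n : ℕ, σ ^ n = g := by
  have h : σ = FiniteField.frobeniusAlgEquivOfAlgebraic k K := by
    ext x
    simp [hσ]
  obtain ⟨n, hn⟩ := (FiniteField.bijective_frobeniusAlgEquivOfAlgebraic_pow k K).2 g
  exact ⟨n, by rw [h]; exact hn⟩

theorem card_units_mem_frobIdeal {k K : Type} [Field k] [Field K] [Fintype k]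
    [Fintype K] [Algebra k K] (σ : K ≃ₐ[k] K) (hσ : ∀ x, σ x = x ^ Fintype.card k) :
    ((Nat.card Kˣ : ℤ) : MonoidAlgebra ℤ (K ≃ₐ[k] K)) ∈ frobIdeal k K σ := by
  have hone : σ ^ Module.finrank k K = 1 := by
    have h : σ = FiniteField.frobeniusAlgEquivOfAlgebraic k K := by
      ext x
      simp [hσ]
    rw [h, ← FiniteField.orderOf_frobeniusAlgEquivOfAlgebraic, pow_orderOf_eq_one]
  have h := of_pow_sub_card_pow_mem_frobIdeal σ (Module.finrank k K)
  rw [hone, map_one, ← Nat.cast_pow, ← Module.card_eq_pow_finrank (K := k) (V := K)] at h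
  have hc : Fintype.card K = Nat.card Kˣ + 1 := by
    rw [Nat.card_units, Nat.card_eq_fintype_card]
    have := Fintype.card_pos (α := K)
    lia
  rw [hc] at h
  simpa using neg_mem h

theorem groupRingUnitsAction_eq_zero_of_mem_frobIdeal {k K : Type} [Field k] [Field K]
    [Fintype k] [Algebra k K] (σ : K ≃ₐ[k] K) (hσ : ∀ x, σ x = x ^ Fintype.card k)
    {a : MonoidAlgebra ℤ (K ≃ₐ[k] K)} (ha : a ∈ frobIdeal k K σ) :
    groupRingUnitsAction k K a = 0 := by
  obtain ⟨b, rfl⟩ := Ideal.mem_span_singleton'.1 ha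
  suffices h : groupRingUnitsAction k K ((Fintype.card k : MonoidAlgebra ℤ (K ≃ₐ[k] K)) *
      MonoidAlgebra.of ℤ (K ≃ₐ[k] K) σ⁻¹) = 1 by
    rw [map_mul, map_sub, h, map_one, sub_self, mul_zero]
  rw [(Nat.cast_commute _ _).eq]
  ext x
  rw [groupRingUnitsAction_of_mul, ← Int.cast_natCast, groupRingUnitsAction_intCast]
  apply σ.injective
  rw [← AlgEquiv.mul_apply, mul_inv_cancel, hσ]
  simp

theorem groupRingUnitsAction_apply_eq_zero_iff {k K : Type} [Field k] [Field K]
    [Fintype k] [Fintype K] [Algebra k K] (σ : K ≃ₐ[k] K)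
    (hσ : ∀ x, σ x = x ^ Fintype.card k) {u : Kˣ} (hu : orderOf u = Nat.card Kˣ)
    (a : MonoidAlgebra ℤ (K ≃ₐ[k] K)) :
    groupRingUnitsAction k K a (Additive.ofMul u) = 0 ↔ a ∈ frobIdeal k K σ := by
  refine ⟨fun h ↦ ?_, fun h ↦ by
    rw [groupRingUnitsAction_eq_zero_of_mem_frobIdeal σ hσ h, LinearMap.zero_apply]⟩
  obtain ⟨m, hm⟩ :=
    exists_intCast_sub_mem_frobIdeal σ (exists_pow_eq_of_forall_eq_pow_card σ hσ) a
  have hzero := groupRingUnitsAction_eq_zero_of_mem_frobIdeal σ hσ hm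
  rw [map_sub, sub_eq_zero] at hzero
  rw [hzero, groupRingUnitsAction_intCast, ← ofMul_zpow, ofMul_eq_zero,
    ← orderOf_dvd_iff_zpow_eq_one, hu] at h
  obtain ⟨c, rfl⟩ := h
  rw [← sub_add_cancel a (((Nat.card Kˣ * c : ℤ)) : MonoidAlgebra ℤ (K ≃ₐ[k] K))]
  refine add_mem hm ?_
  rw [mul_comm, Int.cast_mul]
  exact Ideal.mul_mem_left _ _ (card_units_mem_frobIdeal σ hσ)

/-- **The multiplicative group of a finite field extension as a Galois module**: for an
extension `K/k` of finite fields with `|k| = q`, `G = Gal(K/k)` generated by the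
Frobenius `σ : x ↦ x^q`, the `ℤ[G]`-module `K^×` is isomorphic to `ℤ[G]/(1 - qσ⁻¹)`:
there is an additive isomorphism `e : ℤ[G]/(1 - qσ⁻¹) ≃ K^×` (the latter written
additively) which is `G`-equivariant, hence `ℤ[G]`-linear. -/
theorem units_of_finite_field_as_galois_module
    (k K : Type) [Field k] [Field K] [Fintype k] [Fintype K] [Algebra k K]
    (q f : ℕ) (hq : q = Fintype.card k) (hf : f = Module.finrank k K)
    (σ : K ≃ₐ[k] K) (hσ : ∀ x : K, σ x = x ^ q) :
    ∃ e : (MonoidAlgebra ℤ (K ≃ₐ[k] K) ⧸ frobIdeal k K σ) ≃+ Additive Kˣ,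
      ∀ (g : K ≃ₐ[k] K) (a : MonoidAlgebra ℤ (K ≃ₐ[k] K)),
        ((Additive.toMul (e (Submodule.Quotient.mk
            (MonoidAlgebra.of ℤ (K ≃ₐ[k] K) g * a))) : Kˣ) : K)
          = g (((Additive.toMul (e (Submodule.Quotient.mk a)) : Kˣ) : K)) := by
  subst hq
  obtain ⟨u, hu⟩ := IsCyclic.exists_generator (α := Kˣ)
  let φ : MonoidAlgebra ℤ (K ≃ₐ[k] K) →+ Additive Kˣ :=
    ((LinearMap.applyₗ (Additive.ofMul u)).comp
      (groupRingUnitsAction k K).toLinearMap).toAddMonoidHom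
  have hker : (frobIdeal k K σ).toAddSubgroup = φ.ker := by
    ext a
    exact (groupRingUnitsAction_apply_eq_zero_iff σ hσ
      (orderOf_eq_card_of_forall_mem_zpowers hu) a).symm
  have hsurj : Function.Surjective φ := by
    intro x
    obtain ⟨m, hm⟩ := hu x.toMul
    exact ⟨m, (groupRingUnitsAction_intCast m _).trans hm⟩
  exact ⟨(QuotientAddGroup.quotientAddEquivOfEq hker).trans
    (QuotientAddGroup.quotientKerEquivOfSurjective φ hsurj),
    fun g a ↦ groupRingUnitsAction_of_mul g a _⟩
end
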